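/- There exist universal constants c ≥ 3 and K such that the following holds with t = N^{c−1}. Let (X, Y) ∈ [−1/2, 1/2]^{2N}, let ΔX be a centered Gaussian vector on ℝ^N with covariance (ε/t)·I_N, and let ΔY = H·ΔX. Let F: ℝ^{2N} → ℝ be a multilinear function mapping {±1}^{2N} into [−1,1] such that L_{1,2}(F_ρ) ≤ ℓ for every restriction ρ of F. Then for every i ∈ {1, …, t}: |E_{ΔX}[ F(X + ΔX, (Y+ΔY)∘(Y+ΔY) − (iε/t)·𝟙) ] − F(X, Y∘Y − ((i−1)ε/t)·𝟙)| ≤ K·ε·ℓ/(t·√N). -/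

import Mathlib

open MeasureTheory ProbabilityTheory Finset

noncomputable section

/-- Bit strings of length `n`; there are `N = 2^n` of them. -/
abbrev BV (n : ℕ) := Fin n → Bool

/-- Inner product (mod nothing, just the count) of two bit strings. -/
def bip {n : ℕ} (x y : BV n) : ℕ := (Finset.univ.filter fun i => x i && y i).card

/-- The `N × N` normalized Walsh-Hadamard matrix, `H_{x,y} = (-1)^{⟨x,y⟩} / √N`. -/
def Had (n : ℕ) : Matrix (BV n) (BV n) ℝ :=
  Matrix.of fun x y => (-1 : ℝ) ^ bip x y / Real.sqrt (2 ^ n)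

/-- `ε = 1 / (C ln N)` with `N = 2^n`. -/
def eps (C : ℝ) (n : ℕ) : ℝ := 1 / (C * Real.log (2 ^ n))

/-- The Gaussian vector `X` with i.i.d. `N(0, ε)` coordinates. -/
def gaussVec (C : ℝ) (n : ℕ) : Measure (BV n → ℝ) :=
  Measure.pi fun _ => gaussianReal 0 (eps C n).toNNReal

/-- The distribution `G'` of `Z = (X, Y∘Y - ε·𝟙)` with `Y = H·X`, packed as a
function on `BV n ⊕ BV n` (first `N` coordinates are `X`, last `N` are `Y∘Y - ε`). -/
def Gmeas' (C : ℝ) (n : ℕ) : Measure (BV n ⊕ BV n → ℝ) :=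
  (gaussVec C n).map fun X => Sum.elim X fun i => ((Had n).mulVec X i) ^ 2 - eps C n

/-- Truncation to `[-1, 1]`. -/
def trnc (a : ℝ) : ℝ := min 1 (max (-1) a)

/-- Randomized rounding of `a` to `±1`: output `1` with probability `(1 + trnc a)/2`
and `-1` with probability `(1 - trnc a)/2`. -/
def roundM (a : ℝ) : Measure ℝ :=
  ((1 + trnc a) / 2).toNNReal • Measure.dirac 1 +
    ((1 - trnc a) / 2).toNNReal • Measure.dirac (-1)

/-- The distribution `D` on `{±1}^{2N}`: sample `z ~ G'` and round each coordinate
independently. -/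
def Dmeas (C : ℝ) (n : ℕ) : Measure (BV n ⊕ BV n → ℝ) :=
  (Gmeas' C n).bind fun z => Measure.pi fun i => roundM (z i)

/-- `F : ℝ^ι → ℝ` is multilinear if `F z = Σ_S F̂(S) ∏_{i ∈ S} z_i`. -/
def IsMultilinear {ι : Type*} [Fintype ι] [DecidableEq ι] (F : (ι → ℝ) → ℝ) : Prop :=
  ∃ c : Finset ι → ℝ, ∀ z, F z = ∑ S : Finset ι, c S * ∏ i ∈ S, z i

/-- The Fourier coefficient `F̂(S)` of `F` (over the hypercube `{±1}^ι`); for a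
multilinear `F` these are precisely its multilinear coefficients. -/
def mlCoeff {ι : Type*} [Fintype ι] [DecidableEq ι] (F : (ι → ℝ) → ℝ) (S : Finset ι) : ℝ :=
  (∑ z : ι → Bool, F (fun i => if z i then 1 else -1) * ∏ i ∈ S, (if z i then (1 : ℝ) else -1)) /
    2 ^ Fintype.card ι

/-- `L_{1,2}(F) = Σ_{|S| = 2} |F̂(S)|`. -/
def L12 {ι : Type*} [Fintype ι] [DecidableEq ι] (F : (ι → ℝ) → ℝ) : ℝ :=
  ∑ S ∈ Finset.univ.filter (fun S : Finset ι => S.card = 2), |mlCoeff F S|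

/-- The restriction `F_ρ` of `F` under `ρ = (S, w)`: coordinates outside `S` are
fixed to the values of `w`. -/
def restrictML {ι : Type*} [DecidableEq ι] (F : (ι → ℝ) → ℝ) (S : Finset ι)
    (w : ι → ℝ) : (ι → ℝ) → ℝ :=
  fun y => F fun i => if i ∈ S then y i else w i

/-- `φ(X, Y) = (1/N) Σ_i (Σ_j H_{ij} X_j)² Y_i`. -/
def phi (n : ℕ) (X Y : BV n → ℝ) : ℝ :=
  (∑ i, ((Had n).mulVec X i) ^ 2 * Y i) / 2 ^ n

/-- The multilinear part `φ_{i≠j}(X, Y) = (1/N) Σ_i Σ_{j ≠ k} H_{ij} H_{ik} X_j X_k Y_i`. -/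
def phiOff (n : ℕ) (X Y : BV n → ℝ) : ℝ :=
  (∑ i, ∑ j, ∑ k ∈ Finset.univ \ {j}, Had n i j * Had n i k * X j * X k * Y i) / 2 ^ n

/-- The Fourier coefficient `f̂(x) = 2^{-n} Σ_y f(y) (-1)^{⟨x,y⟩}` of `f : {0,1}^n → {±1}`. -/
def hatF (n : ℕ) (f : BV n → ℝ) (x : BV n) : ℝ :=
  (∑ y, f y * (-1 : ℝ) ^ bip x y) / 2 ^ n

/-- The centered Gaussian vector `ΔX` on `ℝ^N` with covariance `(ε/t)·I_N`. -/
def gaussStep (C : ℝ) (n : ℕ) (t : ℝ) : Measure (BV n → ℝ) :=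
  Measure.pi fun _ => gaussianReal 0 (eps C n / t).toNNReal

/-- The coefficient of `∏ i ∈ S, w i` in the expansion of `Σ_T c_T ∏ i ∈ T, (z i + w i)`, that is,
the partial derivative `∂_S` at `z` of the multilinear function with coefficients `c`. -/
def mlDeriv {ι : Type*} [Fintype ι] [DecidableEq ι] (c : Finset ι → ℝ) (z : ι → ℝ)
    (S : Finset ι) : ℝ :=
  ∑ T : Finset ι, c T * ∏ i, if i ∈ S then (if i ∈ T then 1 else 0) else if i ∈ T then z i else 1

section Multilinear

variable {ι : Type*} [Fintype ι] [DecidableEq ι] {F : (ι → ℝ) → ℝ} {c : Finset ι → ℝ}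

lemma multilinear_add (hF : ∀ z, F z = ∑ S : Finset ι, c S * ∏ i ∈ S, z i) (z w : ι → ℝ) :
    F (z + w) = ∑ S : Finset ι, mlDeriv c z S * ∏ i ∈ S, w i := by
  have key : ∀ T : Finset ι, ∏ i ∈ T, (z + w) i = ∑ S : Finset ι,
      (∏ i, if i ∈ S then (if i ∈ T then (1 : ℝ) else 0) else if i ∈ T then z i else 1) *
        ∏ i ∈ S, w i := by
    intro T
    have h1 : ∏ i ∈ T, (z + w) i
        = ∏ i, ((if i ∈ T then w i else 0) + (if i ∈ T then z i else 1)) := by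
      rw [← Finset.prod_subset (Finset.subset_univ T)]
      · refine Finset.prod_congr rfl fun i hi => ?_
        simp [hi, add_comm]
      · intro i _ hi
        simp [hi]
    rw [h1, Fintype.prod_add]
    refine Finset.sum_congr rfl fun S _ => ?_
    rw [← Finset.prod_mul_prod_compl S (fun i => if i ∈ S then (if i ∈ T then (1 : ℝ) else 0)
      else if i ∈ T then z i else 1), mul_right_comm, ← Finset.prod_mul_distrib]
    congr 1
    · refine Finset.prod_congr rfl fun i hi => ?_
      simp [hi]
    · refine Finset.prod_congr rfl fun i hi => ?_
      simp [Finset.mem_compl.mp hi]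
  rw [hF]
  simp_rw [key, mlDeriv, Finset.mul_sum, Finset.sum_mul]
  rw [Finset.sum_comm]
  simp_rw [mul_assoc]

lemma mlDeriv_empty (hF : ∀ z, F z = ∑ S : Finset ι, c S * ∏ i ∈ S, z i) (z : ι → ℝ) :
    mlDeriv c z ∅ = F z := by
  rw [hF, mlDeriv]
  refine Finset.sum_congr rfl fun T _ => ?_
  simp [Finset.prod_ite_mem]

lemma mlCoeff_restrictML (hF : ∀ z, F z = ∑ S : Finset ι, c S * ∏ i ∈ S, z i)
    (U : Finset ι) (w : ι → ℝ) (S : Finset ι) :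
    mlCoeff (restrictML F U w) S = ∑ T : Finset ι, c T * ∏ i,
      if i ∈ S then (if i ∈ T then (if i ∈ U then 1 else 0) else 0)
      else if i ∈ T then (if i ∈ U then 0 else w i) else 1 := by
  have key : ∀ T : Finset ι, (∑ z : ι → Bool,
      (∏ i ∈ T, if i ∈ U then (if z i then (1 : ℝ) else -1) else w i) *
        ∏ i ∈ S, (if z i then (1 : ℝ) else -1)) / 2 ^ Fintype.card ι = ∏ i,
      if i ∈ S then (if i ∈ T then (if i ∈ U then 1 else 0) else 0)
      else if i ∈ T then (if i ∈ U then 0 else w i) else 1 := by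
    intro T
    have h := Finset.prod_univ_sum (fun _ : ι => (Finset.univ : Finset Bool)) fun i b =>
      (if i ∈ T then (if i ∈ U then (if b then (1 : ℝ) else -1) else w i) else 1) *
        (if i ∈ S then (if b then (1 : ℝ) else -1) else 1)
    rw [Fintype.piFinset_univ] at h
    simp_rw [Finset.prod_mul_distrib, Finset.prod_ite_mem, Finset.univ_inter] at h
    rw [← h, div_eq_iff (by positivity), mul_comm, Fintype.card,
      ← Finset.prod_const, ← Finset.prod_mul_distrib]
    refine Finset.prod_congr rfl fun i _ => ?_
    by_cases h1 : i ∈ S <;> by_cases h2 : i ∈ T <;> by_cases h3 : i ∈ U <;>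
      (simp [h1, h2, h3]; try ring)
  simp_rw [← key, mlCoeff, restrictML, hF, Finset.sum_mul, mul_div_assoc', ← Finset.sum_div]
  rw [Finset.sum_comm]
  simp_rw [Finset.mul_sum, mul_assoc]

/-- Averaging the Fourier coefficients of restrictions against a product (signed) measure. -/
lemma sum_mlCoeff_restrictML (hF : ∀ z, F z = ∑ S : Finset ι, c S * ∏ i ∈ S, z i)
    (ν : ι → Bool × Bool → ℝ) (S : Finset ι) :
    ∑ p : ι → Bool × Bool, (∏ i, ν i (p i)) *
        mlCoeff (restrictML F (Finset.univ.filter fun i => (p i).1)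
          (fun i => if (p i).2 then 1 else -1)) S
      = ∑ T : Finset ι, c T * ∏ i, ∑ q : Bool × Bool, ν i q *
        (if i ∈ S then (if i ∈ T then (if q.1 then 1 else 0) else 0)
          else if i ∈ T then (if q.1 then 0 else (if q.2 then 1 else -1)) else 1) := by
  simp_rw [mlCoeff_restrictML hF, Finset.mul_sum]
  rw [Finset.sum_comm]
  refine Finset.sum_congr rfl fun T _ => ?_
  rw [Finset.prod_univ_sum, Fintype.piFinset_univ, Finset.mul_sum]
  refine Finset.sum_congr rfl fun p _ => ?_
  rw [Finset.prod_mul_distrib]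
  simp only [Finset.mem_filter, Finset.mem_univ, true_and]
  ring

variable {ℓ : ℝ}

lemma abs_mlCoeff_le_L12 (G : (ι → ℝ) → ℝ) {S : Finset ι} (hS : S.card = 2) :
    |mlCoeff G S| ≤ L12 G :=
  Finset.single_le_sum (f := fun S => |mlCoeff G S|) (fun _ _ => abs_nonneg _)
    (Finset.mem_filter.mpr ⟨Finset.mem_univ S, hS⟩)

lemma sum_prod_eq_one_of_forall_sum_eq_one {κ : Type*} [Fintype κ] (ν : ι → κ → ℝ)
    (hν : ∀ i, ∑ q, ν i q = 1) : ∑ p : ι → κ, ∏ i, ν i (p i) = 1 := by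
  have h := Finset.prod_univ_sum (fun _ : ι => (Finset.univ : Finset κ)) ν
  rw [Fintype.piFinset_univ] at h
  rw [← h]
  simp [hν]

/-- Second derivatives in the cube of half side are controlled by restrictions. -/
lemma sum_abs_mlDeriv_le (hF : ∀ z, F z = ∑ S : Finset ι, c S * ∏ i ∈ S, z i)
    (hL : ∀ (S : Finset ι) (w : ι → ℝ), (∀ i ∉ S, w i = 1 ∨ w i = -1) →
      L12 (restrictML F S w) ≤ ℓ)
    {z : ι → ℝ} (hz : ∀ i, |z i| ≤ 1 / 2) :
    ∑ S ∈ Finset.univ.filter (fun S : Finset ι => S.card = 2), |mlDeriv c z S| ≤ 4 * ℓ := by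
  set ν : ι → Bool × Bool → ℝ := fun i q => (1 + 2 * (if q.2 then 1 else -1) * z i) / 4 with hν
  have hν0 : ∀ i q, 0 ≤ ν i q := by
    intro i q
    have := abs_le.mp (hz i)
    simp only [hν]
    split_ifs <;> linarith
  have hν1 : ∑ p : ι → Bool × Bool, ∏ i, ν i (p i) = 1 := by
    refine sum_prod_eq_one_of_forall_sum_eq_one ν fun i => ?_
    simp [Fintype.sum_prod_type, hν]
    ring
  have key : ∀ S : Finset ι, S.card = 2 → mlDeriv c z S = 4 * ∑ p : ι → Bool × Bool,
      (∏ i, ν i (p i)) * mlCoeff (restrictML F (Finset.univ.filter fun i => (p i).1)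
        (fun i => if (p i).2 then 1 else -1)) S := by
    intro S hS
    rw [sum_mlCoeff_restrictML hF, mlDeriv, Finset.mul_sum]
    refine Finset.sum_congr rfl fun T _ => ?_
    have h4 : (4 : ℝ) = ∏ i, if i ∈ S then (2 : ℝ) else 1 := by
      rw [Finset.prod_ite_mem, Finset.univ_inter, Finset.prod_const, hS]
      norm_num
    rw [mul_left_comm]
    congr 1
    rw [h4, ← Finset.prod_mul_distrib]
    refine Finset.prod_congr rfl fun i _ => ?_
    by_cases h1 : i ∈ S <;> by_cases h2 : i ∈ T <;>
      simp [h1, h2, Fintype.sum_prod_type, hν] <;> ring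
  calc ∑ S ∈ Finset.univ.filter (fun S : Finset ι => S.card = 2), |mlDeriv c z S|
      ≤ ∑ S ∈ Finset.univ.filter (fun S : Finset ι => S.card = 2), ∑ p : ι → Bool × Bool,
          4 * ((∏ i, ν i (p i)) * |mlCoeff (restrictML F (Finset.univ.filter fun i => (p i).1)
            (fun i => if (p i).2 then 1 else -1)) S|) := by
        refine Finset.sum_le_sum fun S hS => ?_
        rw [key S (Finset.mem_filter.mp hS).2, abs_mul, abs_of_pos (by norm_num : (0 : ℝ) < 4),
          ← Finset.mul_sum]
        gcongr
        refine (Finset.abs_sum_le_sum_abs _ _).trans_eq (Finset.sum_congr rfl fun p _ => ?_)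
        rw [abs_mul, abs_of_nonneg (Finset.prod_nonneg fun i _ => hν0 i _)]
    _ = ∑ p : ι → Bool × Bool, 4 * ((∏ i, ν i (p i)) *
          L12 (restrictML F (Finset.univ.filter fun i => (p i).1)
            (fun i => if (p i).2 then 1 else -1))) := by
        rw [Finset.sum_comm]
        simp_rw [L12, Finset.mul_sum]
    _ ≤ ∑ p : ι → Bool × Bool, 4 * ((∏ i, ν i (p i)) * ℓ) := by
        refine Finset.sum_le_sum fun p _ => ?_
        gcongr
        · exact Finset.prod_nonneg fun i _ => hν0 i _
        · exact hL _ _ fun i _ => by by_cases h : (p i).2 <;> simp [h]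
    _ = 4 * ℓ := by
        rw [← Finset.mul_sum, ← Finset.sum_mul, hν1, one_mul]

/-- Derivatives of order at least two are bounded by `ℓ` on the cube. -/
lemma abs_mlDeriv_le (hF : ∀ z, F z = ∑ S : Finset ι, c S * ∏ i ∈ S, z i)
    (hL : ∀ (S : Finset ι) (w : ι → ℝ), (∀ i ∉ S, w i = 1 ∨ w i = -1) →
      L12 (restrictML F S w) ≤ ℓ)
    {z : ι → ℝ} (hz : ∀ i, |z i| ≤ 1) {S : Finset ι} (hS : 2 ≤ S.card) :
    |mlDeriv c z S| ≤ ℓ := by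
  obtain ⟨P, hPS, hP⟩ := Finset.exists_subset_card_eq hS
  set ν : ι → Bool × Bool → ℝ := fun i q =>
    if i ∈ P then (if q.1 && q.2 then 1 else 0)
    else if q.1 then 0
    else if i ∈ S then (if q.2 then 1 else -1) / 2
    else (1 + (if q.2 then 1 else -1) * z i) / 2 with hν
  have hν1 : ∑ p : ι → Bool × Bool, ∏ i, |ν i (p i)| = 1 := by
    refine sum_prod_eq_one_of_forall_sum_eq_one (fun i q => |ν i q|) fun i => ?_
    have hzi := abs_le.mp (hz i)
    have e1 : |1 + z i| = 1 + z i := abs_of_nonneg (by linarith)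
    have e2 : |1 + -z i| = 1 - z i := by rw [abs_of_nonneg (by linarith)]; ring
    by_cases h1 : i ∈ P <;> by_cases h2 : i ∈ S <;>
      (simp [Fintype.sum_prod_type, hν, h1, h2, abs_div, e1, e2]; try ring)
  have key : mlDeriv c z S = ∑ p : ι → Bool × Bool,
      (∏ i, ν i (p i)) * mlCoeff (restrictML F (Finset.univ.filter fun i => (p i).1)
        (fun i => if (p i).2 then 1 else -1)) P := by
    rw [sum_mlCoeff_restrictML hF, mlDeriv]
    refine Finset.sum_congr rfl fun T _ => ?_
    congr 1
    refine Finset.prod_congr rfl fun i _ => ?_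
    by_cases h1 : i ∈ P
    · have h2 := hPS h1
      simp only [Fintype.sum_prod_type, Fintype.sum_bool]
      by_cases h3 : i ∈ T <;> simp [hν, h1, h2, h3]
    · by_cases h2 : i ∈ S <;> by_cases h3 : i ∈ T <;>
        simp [Fintype.sum_prod_type, hν, h1, h2, h3] <;> ring
  rw [key]
  calc |∑ p : ι → Bool × Bool, (∏ i, ν i (p i)) *
          mlCoeff (restrictML F (Finset.univ.filter fun i => (p i).1)
            (fun i => if (p i).2 then 1 else -1)) P|
      ≤ ∑ p : ι → Bool × Bool, (∏ i, |ν i (p i)|) * ℓ := by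
        refine (Finset.abs_sum_le_sum_abs _ _).trans (Finset.sum_le_sum fun p _ => ?_)
        rw [abs_mul, Finset.abs_prod]
        gcongr
        refine (abs_mlCoeff_le_L12 _ hP).trans (hL _ _ fun i _ => ?_)
        by_cases h : (p i).2 <;> simp [h]
    _ = ℓ := by rw [← Finset.sum_mul, hν1, one_mul]

end Multilinear

/-- Taylor estimate for a multilinear function at a small centered random displacement. -/
lemma abs_integral_multilinear_sub_le {ι Ω : Type*} [Fintype ι] [DecidableEq ι]
    [MeasurableSpace Ω] {μ : Measure Ω} [IsProbabilityMeasure μ]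
    {F : (ι → ℝ) → ℝ} {c : Finset ι → ℝ} {ℓ : ℝ}
    (hF : ∀ z, F z = ∑ S : Finset ι, c S * ∏ i ∈ S, z i)
    (hL : ∀ (S : Finset ι) (w : ι → ℝ), (∀ i ∉ S, w i = 1 ∨ w i = -1) →
      L12 (restrictML F S w) ≤ ℓ)
    {z : ι → ℝ} (hz : ∀ i, |z i| ≤ 1 / 2)
    {D : Ω → ι → ℝ} (hD : ∀ i, Measurable fun x => D x i)
    {η : ℝ} (hη0 : 0 < η) (hη1 : η ≤ 1)
    {B : Ω → ℝ} (hB : Integrable B μ) (hDB : ∀ x, ∏ i, (1 + |D x i| / η) ≤ B x)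
    (h1 : ∀ i, ∫ x, D x i ∂μ = 0) {r : ℝ} (hr0 : 0 ≤ r)
    (h2 : ∀ i j, i ≠ j → |∫ x, D x i * D x j ∂μ| ≤ r) :
    |(∫ x, F (z + D x) ∂μ) - F z| ≤ 4 * ℓ * r + ℓ * (η ^ 3 * ∫ x, B x ∂μ) := by
  have hexp : ∀ x, ∏ i, (1 + |D x i| / η) = ∑ S : Finset ι, ∏ i ∈ S, |D x i| / η := by
    intro x
    simp_rw [add_comm (1 : ℝ)]
    rw [Fintype.prod_add]
    simp
  have hle : ∀ (S : Finset ι) x, ∏ i ∈ S, |D x i| / η ≤ B x := by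
    intro S x
    refine le_trans ?_ (hDB x)
    rw [hexp]
    exact Finset.single_le_sum (f := fun S : Finset ι => ∏ i ∈ S, |D x i| / η)
      (fun S _ => Finset.prod_nonneg fun i _ => by positivity) (Finset.mem_univ S)
  have hscale : ∀ (S : Finset ι) x, |∏ i ∈ S, D x i| = η ^ S.card * ∏ i ∈ S, |D x i| / η := by
    intro S x
    rw [Finset.abs_prod, Finset.prod_div_distrib, Finset.prod_const]
    field_simp
  have hmeas : ∀ S : Finset ι, Measurable fun x => ∏ i ∈ S, D x i := fun S =>
    Finset.measurable_fun_prod S fun i _ => hD i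
  have hint : ∀ S : Finset ι, Integrable (fun x => ∏ i ∈ S, D x i) μ := by
    intro S
    refine (hB.const_mul (η ^ S.card)).mono' (hmeas S).aestronglyMeasurable
      (Filter.Eventually.of_forall fun x => ?_)
    rw [Real.norm_eq_abs, hscale]
    gcongr
    exact hle S x
  have hℓ : 0 ≤ ℓ := le_trans (Finset.sum_nonneg fun _ _ => abs_nonneg _)
    (hL Finset.univ (fun _ => 1) (by simp))
  have hr : ∀ S : Finset ι, S.card = 2 → |∫ x, ∏ i ∈ S, D x i ∂μ| ≤ r := by
    intro S hS
    obtain ⟨i, j, hij, rfl⟩ := Finset.card_eq_two.mp hS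
    simp_rw [Finset.prod_pair hij]
    exact h2 i j hij
  have hsmall : ∑ S ∈ Finset.univ.filter (fun S : Finset ι => 3 ≤ S.card),
      |∫ x, ∏ i ∈ S, D x i ∂μ| ≤ η ^ 3 * ∫ x, B x ∂μ := by
    calc ∑ S ∈ Finset.univ.filter (fun S : Finset ι => 3 ≤ S.card), |∫ x, ∏ i ∈ S, D x i ∂μ|
        ≤ ∑ S ∈ Finset.univ.filter (fun S : Finset ι => 3 ≤ S.card),
            ∫ x, |∏ i ∈ S, D x i| ∂μ :=
          Finset.sum_le_sum fun S _ => abs_integral_le_integral_abs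
      _ = ∫ x, ∑ S ∈ Finset.univ.filter (fun S : Finset ι => 3 ≤ S.card),
            |∏ i ∈ S, D x i| ∂μ := (integral_finsetSum _ fun S _ => (hint S).abs).symm
      _ ≤ ∫ x, η ^ 3 * B x ∂μ := by
          refine integral_mono (integrable_finsetSum _ fun S _ => (hint S).abs)
            (hB.const_mul _) fun x => ?_
          calc ∑ S ∈ Finset.univ.filter (fun S : Finset ι => 3 ≤ S.card), |∏ i ∈ S, D x i|
              ≤ ∑ S ∈ Finset.univ.filter (fun S : Finset ι => 3 ≤ S.card),
                  η ^ 3 * ∏ i ∈ S, |D x i| / η := by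
                refine Finset.sum_le_sum fun S hS => ?_
                rw [hscale]
                refine mul_le_mul_of_nonneg_right ?_
                  (Finset.prod_nonneg fun i _ => by positivity)
                exact pow_le_pow_of_le_one hη0.le hη1 (Finset.mem_filter.mp hS).2
            _ ≤ ∑ S : Finset ι, η ^ 3 * ∏ i ∈ S, |D x i| / η :=
                Finset.sum_le_sum_of_subset_of_nonneg (Finset.filter_subset _ _)
                  fun S _ _ => mul_nonneg (by positivity)
                    (Finset.prod_nonneg fun i _ => by positivity)
            _ ≤ η ^ 3 * B x := by
                rw [← Finset.mul_sum, ← hexp]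
                gcongr
                exact hDB x
      _ = η ^ 3 * ∫ x, B x ∂μ := integral_const_mul _ _
  have hmain : (∫ x, F (z + D x) ∂μ) - F z
      = ∑ S : Finset ι, if S = ∅ then 0 else mlDeriv c z S * ∫ x, ∏ i ∈ S, D x i ∂μ := by
    simp_rw [multilinear_add hF]
    rw [integral_finsetSum _ fun S _ => (hint S).const_mul _, ← mlDeriv_empty hF z]
    simp_rw [integral_const_mul]
    rw [← Finset.sum_erase_add _ _ (Finset.mem_univ (∅ : Finset ι)),
      ← Finset.sum_erase_add _ _ (Finset.mem_univ (∅ : Finset ι))]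
    simp only [Finset.prod_empty, integral_const, probReal_univ, smul_eq_mul, mul_one,
      add_sub_cancel_right, if_true, add_zero]
    exact Finset.sum_congr rfl fun S hS => by rw [if_neg (Finset.ne_of_mem_erase hS)]
  rw [hmain]
  calc |∑ S : Finset ι, if S = ∅ then 0 else mlDeriv c z S * ∫ x, ∏ i ∈ S, D x i ∂μ|
      ≤ ∑ S : Finset ι, ((if S.card = 2 then |mlDeriv c z S| * r else 0) +
          (if 3 ≤ S.card then ℓ * |∫ x, ∏ i ∈ S, D x i ∂μ| else 0)) := by
        refine (Finset.abs_sum_le_sum_abs _ _).trans (Finset.sum_le_sum fun S _ => ?_)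
        by_cases h0 : S = ∅
        · simp [h0]
        have hpos : 0 < S.card := Finset.card_pos.mpr (Finset.nonempty_iff_ne_empty.mpr h0)
        rw [if_neg h0, abs_mul]
        rcases (by omega : S.card = 1 ∨ S.card = 2 ∨ 3 ≤ S.card) with h | h | h
        · obtain ⟨i, rfl⟩ := Finset.card_eq_one.mp h
          simp [h1]
        · rw [if_pos h, if_neg (by omega), add_zero]
          gcongr
          exact hr S h
        · rw [if_neg (by omega), if_pos h, zero_add]
          gcongr
          exact abs_mlDeriv_le hF hL (fun i => (hz i).trans (by norm_num)) (by omega)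
    _ = (∑ S ∈ Finset.univ.filter (fun S : Finset ι => S.card = 2), |mlDeriv c z S|) * r +
          ℓ * ∑ S ∈ Finset.univ.filter (fun S : Finset ι => 3 ≤ S.card),
            |∫ x, ∏ i ∈ S, D x i ∂μ| := by
        rw [Finset.sum_add_distrib, Finset.sum_mul, Finset.mul_sum, Finset.sum_filter,
          Finset.sum_filter]
    _ ≤ 4 * ℓ * r + ℓ * (η ^ 3 * ∫ x, B x ∂μ) := by
        refine add_le_add ?_ (mul_le_mul_of_nonneg_left hsmall hℓ)
        exact mul_le_mul_of_nonneg_right (sum_abs_mlDeriv_le hF hL hz) hr0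

section Gaussian

variable {ι : Type*} [Fintype ι]

lemma integrable_exp_mul_sum_abs [Nonempty ι] (v : NNReal) {β : ℝ} :
    Integrable (fun x : ι → ℝ => Real.exp (β * ∑ a, |x a|))
        (Measure.pi fun _ => gaussianReal 0 v) ∧
      ∫ x : ι → ℝ, Real.exp (β * ∑ a, |x a|) ∂(Measure.pi fun _ => gaussianReal 0 v)
        ≤ 2 * Real.exp (v * (Fintype.card ι * β) ^ 2 / 2) := by
  set N : ℝ := (Fintype.card ι : ℝ)
  have hN : 0 < N := by simp only [N]; exact_mod_cast Fintype.card_pos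
  set G : (ι → ℝ) → ℝ := fun x =>
    ∑ a, N⁻¹ * (Real.exp (N * β * x a) + Real.exp (-(N * β) * x a))
  have hi : ∀ (s : ℝ) (a : ι), Integrable (fun x : ι → ℝ => Real.exp (s * x a))
      (Measure.pi fun _ => gaussianReal 0 v) := fun s a =>
    integrable_comp_eval (μ := fun _ : ι => gaussianReal 0 v) (i := a)
      (f := fun y => Real.exp (s * y)) (integrable_exp_mul_gaussianReal s)
  have hv : ∀ (s : ℝ) (a : ι), ∫ x : ι → ℝ, Real.exp (s * x a)
      ∂(Measure.pi fun _ => gaussianReal 0 v) = Real.exp (v * s ^ 2 / 2) := by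
    intro s a
    rw [integral_comp_eval (μ := fun _ : ι => gaussianReal 0 v)
      (f := fun y => Real.exp (s * y)) (by fun_prop)]
    have := congrFun (mgf_id_gaussianReal (μ := 0) (v := v)) s
    simpa [mgf] using this
  have hii : ∀ a : ι, Integrable (fun x : ι → ℝ =>
      Real.exp (N * β * x a) + Real.exp (-(N * β) * x a))
      (Measure.pi fun _ => gaussianReal 0 v) := fun a => (hi _ a).add (hi _ a)
  have hGi : Integrable G (Measure.pi fun _ => gaussianReal 0 v) :=
    integrable_finsetSum _ fun a _ => (hii a).const_mul _
  have hle : ∀ x : ι → ℝ, Real.exp (β * ∑ a, |x a|) ≤ G x := by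
    intro x
    have h := convexOn_exp.map_sum_le (t := Finset.univ) (w := fun _ : ι => N⁻¹)
      (p := fun a => N * β * |x a|) (fun _ _ => by positivity)
      (by simp [N]) (fun _ _ => Set.mem_univ _)
    have e : ∑ a, N⁻¹ • (N * β * |x a|) = β * ∑ a, |x a| := by
      rw [Finset.mul_sum]
      refine Finset.sum_congr rfl fun a _ => ?_
      rw [smul_eq_mul]
      field_simp
    rw [e] at h
    refine h.trans (Finset.sum_le_sum fun a _ => ?_)
    rw [smul_eq_mul]
    gcongr
    rcases abs_choice (x a) with h | h <;> rw [h]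
    · linarith [Real.exp_pos (-(N * β) * x a)]
    · rw [mul_neg, ← neg_mul]
      linarith [Real.exp_pos (N * β * x a)]
  have hI : Integrable (fun x : ι → ℝ => Real.exp (β * ∑ a, |x a|))
      (Measure.pi fun _ => gaussianReal 0 v) := by
    have hc : Continuous fun x : ι → ℝ => Real.exp (β * ∑ a, |x a|) := by fun_prop
    refine hGi.mono' hc.aestronglyMeasurable (Filter.Eventually.of_forall fun x => ?_)
    rw [Real.norm_eq_abs, abs_of_pos (Real.exp_pos _)]
    exact hle x
  refine ⟨hI, (integral_mono hI hGi hle).trans_eq ?_⟩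
  simp only [G]
  rw [integral_finsetSum _ fun a _ => (hii a).const_mul _]
  simp_rw [integral_const_mul, integral_add (hi _ _) (hi _ _), hv, Finset.sum_const, neg_sq]
  rw [Finset.card_univ, nsmul_eq_mul]
  change N * _ = _
  field_simp
  ring

lemma integrable_eval_gaussian (v : NNReal) (a : ι) :
    Integrable (fun x : ι → ℝ => x a) (Measure.pi fun _ => gaussianReal 0 v) :=
  integrable_comp_eval (f := fun y => y)
    ((memLp_id_gaussianReal 1).integrable le_rfl)

lemma integral_eval_gaussian (v : NNReal) (a : ι) :
    ∫ x : ι → ℝ, x a ∂(Measure.pi fun _ => gaussianReal 0 v) = 0 := by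
  rw [integral_comp_eval (μ := fun _ : ι => gaussianReal 0 v) (f := fun y => y) (by fun_prop),
    integral_id_gaussianReal]

lemma memLp_eval_gaussian (v : NNReal) (a : ι) :
    MemLp (fun x : ι → ℝ => x a) 2 (Measure.pi fun _ => gaussianReal 0 v) :=
  (memLp_id_gaussianReal 2).comp_measurePreserving
    (measurePreserving_eval (fun _ : ι => gaussianReal 0 v) a)

lemma integral_eval_mul_eval_gaussian [DecidableEq ι] (v : NNReal) (a b : ι) :
    ∫ x : ι → ℝ, x a * x b ∂(Measure.pi fun _ => gaussianReal 0 v)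
      = if a = b then (v : ℝ) else 0 := by
  split_ifs with h
  · subst h
    rw [integral_comp_eval (μ := fun _ : ι => gaussianReal 0 v) (f := fun y => y * y)
      (by fun_prop)]
    have h := variance_id_gaussianReal (μ := 0) (v := v)
    rw [variance_eq_integral (by fun_prop)] at h
    simpa [pow_two] using h
  · have hind := iIndepFun_pi (μ := fun _ : ι => gaussianReal 0 v) (X := fun _ y => y)
      (fun _ => by fun_prop)
    rw [(hind.indepFun h).integral_fun_mul_eq_mul_integral
      (integrable_eval_gaussian v a).aestronglyMeasurable
      (integrable_eval_gaussian v b).aestronglyMeasurable,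
      integral_eval_gaussian, zero_mul]

end Gaussian

lemma neg_one_pow_bip {n : ℕ} (x y : BV n) :
    (-1 : ℝ) ^ bip x y = ∏ i, if x i && y i then -1 else 1 := by
  rw [bip, Finset.prod_ite]
  simp

lemma abs_Had (n : ℕ) (a b : BV n) : |Had n a b| = 1 / √(2 ^ n) := by
  simp [Had, abs_div, abs_of_nonneg (Real.sqrt_nonneg _)]

lemma sum_Had_mul_Had (n : ℕ) (a b : BV n) :
    ∑ x, Had n a x * Had n b x = if a = b then 1 else 0 := by
  have h := Finset.prod_univ_sum (fun _ : Fin n => (Finset.univ : Finset Bool)) fun i u =>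
    (if a i && u then (-1 : ℝ) else 1) * (if b i && u then -1 else 1)
  rw [Fintype.piFinset_univ] at h
  simp_rw [Finset.prod_mul_distrib, ← neg_one_pow_bip] at h
  have h1 : ∑ x, Had n a x * Had n b x
      = (∑ x : BV n, (-1 : ℝ) ^ bip a x * (-1 : ℝ) ^ bip b x) / 2 ^ n := by
    rw [Finset.sum_div]
    refine Finset.sum_congr rfl fun x _ => ?_
    simp only [Had, Matrix.of_apply]
    rw [div_mul_div_comm, Real.mul_self_sqrt (by positivity)]
  rw [h1, ← h, div_eq_iff (by positivity)]
  split_ifs with hab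
  · subst hab
    have : ∀ i, ∑ u : Bool, (if a i && u then (-1 : ℝ) else 1) * (if a i && u then -1 else 1)
        = 2 := by
      intro i
      cases h : a i <;> (simp; try norm_num)
    simp only [this]
    simp
  · obtain ⟨i, hi⟩ := Function.ne_iff.mp hab
    rw [zero_mul]
    refine Finset.prod_eq_zero (Finset.mem_univ i) ?_
    cases ha : a i <;> cases hb : b i <;> simp_all

section Walsh

variable {n : ℕ}

lemma abs_Had_le_one (a b : BV n) : |Had n a b| ≤ 1 := by
  rw [abs_Had, div_le_one (by positivity)]
  exact Real.one_le_sqrt.mpr (one_le_pow₀ (by norm_num))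

lemma abs_Had_mulVec_le (x : BV n → ℝ) (b : BV n) : |(Had n).mulVec x b| ≤ ∑ a, |x a| := by
  refine (Finset.abs_sum_le_sum_abs _ _).trans (Finset.sum_le_sum fun a _ => ?_)
  rw [abs_mul]
  exact mul_le_of_le_one_left (abs_nonneg _) (abs_Had_le_one b a)

variable (v : NNReal)

lemma memLp_Had_mulVec (b : BV n) :
    MemLp (fun x => (Had n).mulVec x b) 2 (Measure.pi fun _ => gaussianReal 0 v) :=
  memLp_finsetSum _ fun a _ => (memLp_eval_gaussian v a).const_mul _

lemma integral_Had_mulVec (b : BV n) :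
    ∫ x, (Had n).mulVec x b ∂(Measure.pi fun _ => gaussianReal 0 v) = 0 := by
  simp_rw [Matrix.mulVec, dotProduct]
  rw [integral_finsetSum _ fun a _ => (integrable_eval_gaussian v a).const_mul _]
  simp_rw [integral_const_mul, integral_eval_gaussian, mul_zero, Finset.sum_const_zero]

lemma integrable_eval_mul_Had_mulVec (a b : BV n) :
    Integrable (fun x => x a * (Had n).mulVec x b) (Measure.pi fun _ => gaussianReal 0 v) :=
  (memLp_eval_gaussian v a).integrable_mul (memLp_Had_mulVec v b)

lemma integral_eval_mul_Had_mulVec (a b : BV n) :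
    ∫ x, x a * (Had n).mulVec x b ∂(Measure.pi fun _ => gaussianReal 0 v) = v * Had n b a := by
  simp_rw [Matrix.mulVec, dotProduct, Finset.mul_sum, mul_left_comm (_ : ℝ) (Had n _ _)]
  have hi : ∀ c, Integrable (fun x : BV n → ℝ => x a * x c)
      (Measure.pi fun _ => gaussianReal 0 v) := fun c =>
    (memLp_eval_gaussian v a).integrable_mul (memLp_eval_gaussian v c)
  rw [integral_finsetSum _ fun c _ => (hi c).const_mul _]
  simp_rw [integral_const_mul, integral_eval_mul_eval_gaussian]
  simp [mul_comm]

lemma integral_Had_mulVec_mul_Had_mulVec (b c : BV n) :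
    ∫ x, (Had n).mulVec x b * (Had n).mulVec x c ∂(Measure.pi fun _ => gaussianReal 0 v)
      = if b = c then (v : ℝ) else 0 := by
  have h : ∀ x : BV n → ℝ, (Had n).mulVec x b * (Had n).mulVec x c
      = ∑ a, Had n b a * (x a * (Had n).mulVec x c) := by
    intro x
    conv_lhs => rw [Matrix.mulVec, dotProduct, Finset.sum_mul]
    simp_rw [mul_assoc]
  simp_rw [h]
  rw [integral_finsetSum _ fun a _ => (integrable_eval_mul_Had_mulVec v a c).const_mul _]
  simp_rw [integral_const_mul, integral_eval_mul_Had_mulVec, mul_left_comm _ (v : ℝ),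
    ← Finset.mul_sum, sum_Had_mul_Had]
  simp

/-- The displacement of `(X, Y∘Y - s·𝟙)` when `X` moves by `x` and `s` by `v`. -/
def walshIncr (n : ℕ) (v : ℝ) (Y x : BV n → ℝ) : BV n ⊕ BV n → ℝ :=
  Sum.elim x fun b => 2 * Y b * (Had n).mulVec x b + (Had n).mulVec x b ^ 2 - v

lemma continuous_Had_mulVec (b : BV n) : Continuous fun x => (Had n).mulVec x b := by
  unfold Matrix.mulVec dotProduct
  fun_prop

lemma measurable_walshIncr (v : ℝ) (Y : BV n → ℝ) (i : BV n ⊕ BV n) :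
    Measurable fun x => walshIncr n v Y x i := by
  have := fun b => (continuous_Had_mulVec (n := n) b).measurable
  rcases i with a | b
  · exact measurable_pi_apply a
  · simp only [walshIncr, Sum.elim_inr]
    fun_prop

variable {Y : BV n → ℝ}

lemma integral_walshIncr (i : BV n ⊕ BV n) :
    ∫ x, walshIncr n v Y x i ∂(Measure.pi fun _ => gaussianReal 0 v) = 0 := by
  rcases i with a | b
  · exact integral_eval_gaussian v a
  · have h1 := ((memLp_Had_mulVec v b).integrable one_le_two).const_mul (2 * Y b)
    have h2 := (memLp_Had_mulVec v b).integrable_sq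
    have h12 : Integrable (fun x => 2 * Y b * (Had n).mulVec x b + (Had n).mulVec x b ^ 2)
        (Measure.pi fun _ => gaussianReal 0 v) := h1.add h2
    simp only [walshIncr, Sum.elim_inr]
    rw [integral_sub h12 (integrable_const _), integral_add h1 h2, integral_const_mul,
      integral_Had_mulVec]
    have h3 := integral_Had_mulVec_mul_Had_mulVec v b b
    simp_rw [← pow_two, if_true] at h3
    simp [h3]

lemma abs_walshIncr_le (hY : ∀ a, |Y a| ≤ 1 / 2) (x : BV n → ℝ) (i : BV n ⊕ BV n) :
    |walshIncr n v Y x i| ≤ (∑ a, |x a|) + (∑ a, |x a|) ^ 2 + v := by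
  have hv := v.coe_nonneg
  rcases i with a | b
  · have h := Finset.single_le_sum (f := fun a => |x a|) (fun _ _ => abs_nonneg _)
      (Finset.mem_univ a)
    have h2 := sq_nonneg (∑ a, |x a|)
    simp only [walshIncr, Sum.elim_inl]
    linarith
  · have h := abs_Had_mulVec_le x b
    set y := (Had n).mulVec x b
    have h1 : |2 * Y b * y| ≤ |y| := by
      rw [abs_mul, abs_mul, abs_two]
      exact mul_le_of_le_one_left (abs_nonneg _) (by linarith [hY b])
    have h2 : |y ^ 2| ≤ (∑ a, |x a|) ^ 2 := by
      rw [abs_pow]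
      gcongr
    simp only [walshIncr, Sum.elim_inr]
    calc |2 * Y b * y + y ^ 2 - v| ≤ |2 * Y b * y| + |y ^ 2| + |(v : ℝ)| :=
          (abs_sub _ _).trans (by gcongr; exact abs_add_le _ _)
      _ ≤ _ := by rw [abs_of_nonneg hv]; linarith

lemma one_add_div_le_exp {L η v : ℝ} (hL : 0 ≤ L) (hη0 : 0 < η) (hη1 : η ≤ 1) (hv : 0 ≤ v) :
    1 + (L + L ^ 2 + v) / η ≤ Real.exp (2 * (L / η) + v / η) := by
  obtain ⟨lam, rfl⟩ : ∃ lam, L = η * lam := ⟨L / η, by field_simp⟩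
  have hlam : 0 ≤ lam := nonneg_of_mul_nonneg_right hL hη0
  have hδ : 0 ≤ v / η := by positivity
  have e : (η * lam + (η * lam) ^ 2 + v) / η = lam + η * lam ^ 2 + v / η := by
    field_simp
  have h1 : η * lam ^ 2 ≤ lam ^ 2 := mul_le_of_le_one_left (sq_nonneg _) hη1
  have h2 := Real.quadratic_le_exp_of_nonneg (x := 2 * lam) (by positivity)
  have h3 := Real.add_one_le_exp (v / η)
  rw [e, mul_div_cancel_left₀ _ hη0.ne', Real.exp_add]
  calc 1 + (lam + η * lam ^ 2 + v / η)
      ≤ (1 + 2 * lam + (2 * lam) ^ 2 / 2) * (v / η + 1) := by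
        nlinarith [mul_nonneg hlam hδ, mul_nonneg (sq_nonneg lam) hδ]
    _ ≤ Real.exp (2 * lam) * Real.exp (v / η) := by gcongr

lemma cubic_le_exp {L η v N : ℝ} (hL : 0 ≤ L) (hη0 : 0 < η) (hη1 : η ≤ 1) (hv0 : 0 ≤ v)
    (hv : v ≤ η ^ 2) (hN : 1 ≤ N) :
    2 * L ^ 3 + (L ^ 2 + v) ^ 2 ≤ 2 * η ^ 3 * Real.exp (4 * N / η * L) := by
  obtain ⟨lam, rfl⟩ : ∃ lam, L = η * lam := ⟨L / η, by field_simp⟩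
  have hlam : 0 ≤ lam := nonneg_of_mul_nonneg_right hL hη0
  have e : 4 * N / η * (η * lam) = 4 * N * lam := by field_simp
  have h1 : (1 + lam) ^ 4 ≤ Real.exp (4 * N * lam) := by
    calc (1 + lam) ^ 4 ≤ Real.exp lam ^ 4 := by
          gcongr
          linarith [Real.add_one_le_exp lam]
      _ = Real.exp (4 * lam) := by rw [← Real.exp_nat_mul]; norm_num
      _ ≤ Real.exp (4 * N * lam) := by
          gcongr
          linarith
  rw [e]
  calc 2 * (η * lam) ^ 3 + ((η * lam) ^ 2 + v) ^ 2
      ≤ 2 * (η * lam) ^ 3 + ((η * lam) ^ 2 + η ^ 2) ^ 2 := by gcongr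
    _ = η ^ 3 * (2 * lam ^ 3 + η * (lam ^ 2 + 1) ^ 2) := by ring
    _ ≤ η ^ 3 * (2 * lam ^ 3 + 1 * (lam ^ 2 + 1) ^ 2) := by gcongr
    _ ≤ η ^ 3 * (2 * (1 + lam) ^ 4) := by
        gcongr
        nlinarith [pow_nonneg hlam 2, pow_nonneg hlam 3, pow_nonneg hlam 4]
    _ ≤ η ^ 3 * (2 * Real.exp (4 * N * lam)) := by gcongr
    _ = 2 * η ^ 3 * Real.exp (4 * N * lam) := by ring

lemma abs_integral_le_of_abs_sub_le {Ω : Type*} [MeasurableSpace Ω] {μ : Measure Ω}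
    {f q B : Ω → ℝ} (hf : Measurable f) (hqm : Measurable q) (hq : Integrable q μ)
    (hB : Integrable B μ) (h : ∀ x, |f x - q x| ≤ B x) :
    |∫ x, f x ∂μ| ≤ |∫ x, q x ∂μ| + ∫ x, B x ∂μ := by
  have hsub : Integrable (fun x => f x - q x) μ :=
    hB.mono' (hf.sub hqm).aestronglyMeasurable (Filter.Eventually.of_forall h)
  have e : ∫ x, f x ∂μ = ∫ x, q x ∂μ + ∫ x, (f x - q x) ∂μ := by
    rw [← integral_add hq hsub]
    simp
  rw [e]
  refine (abs_add_le _ _).trans ?_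
  gcongr
  exact abs_integral_le_integral_abs.trans (integral_mono hsub.abs hB h)

lemma abs_integral_walshIncr_mul_le (hY : ∀ a, |Y a| ≤ 1 / 2) {η : ℝ} (hη0 : 0 < η) (hη1 : η ≤ 1)
    (hv : (v : ℝ) ≤ η ^ 2) {i j : BV n ⊕ BV n} (hij : i ≠ j) :
    |∫ x, walshIncr n v Y x i * walshIncr n v Y x j ∂(Measure.pi fun _ => gaussianReal 0 v)|
      ≤ v / √(2 ^ n) + 2 * η ^ 3 * ∫ x : BV n → ℝ, Real.exp (4 * 2 ^ n / η * ∑ a, |x a|)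
        ∂(Measure.pi fun _ => gaussianReal 0 v) := by
  set μ : Measure (BV n → ℝ) := Measure.pi fun _ => gaussianReal 0 v with hμ
  have hv0 := v.coe_nonneg
  have hB : Integrable (fun x : BV n → ℝ =>
      2 * η ^ 3 * Real.exp (4 * 2 ^ n / η * ∑ a, |x a|)) μ :=
    (integrable_exp_mul_sum_abs v).1.const_mul _
  have hcub : ∀ x : BV n → ℝ, 2 * (∑ a, |x a|) ^ 3 + ((∑ a, |x a|) ^ 2 + v) ^ 2
      ≤ 2 * η ^ 3 * Real.exp (4 * 2 ^ n / η * ∑ a, |x a|) := fun x =>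
    cubic_le_exp (Finset.sum_nonneg fun _ _ => abs_nonneg _) hη0 hη1 hv0 hv
      (one_le_pow₀ (by norm_num))
  have hy : ∀ b, Measurable fun x => (Had n).mulVec x b := fun b =>
    (continuous_Had_mulVec (n := n) b).measurable
  have hy1 : ∀ b, Integrable (fun x => (Had n).mulVec x b) μ := fun b =>
    (memLp_Had_mulVec v b).integrable one_le_two
  have hmixed : ∀ a b, |∫ x, walshIncr n v Y x (Sum.inl a) * walshIncr n v Y x (Sum.inr b) ∂μ|
      ≤ v / √(2 ^ n) + 2 * η ^ 3 * ∫ x : BV n → ℝ, Real.exp (4 * 2 ^ n / η * ∑ a, |x a|) ∂μ := by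
    intro a b
    have hxy := integrable_eval_mul_Had_mulVec v a b
    have hq : ∫ x, (2 * Y b * (x a * (Had n).mulVec x b) - v * x a) ∂μ
        = 2 * Y b * (v * Had n b a) := by
      rw [integral_sub (hxy.const_mul _) ((integrable_eval_gaussian v a).const_mul _),
        integral_const_mul, integral_const_mul, integral_eval_mul_Had_mulVec,
        integral_eval_gaussian, mul_zero, sub_zero]
    refine (abs_integral_le_of_abs_sub_le
      ((measurable_walshIncr _ _ _).mul (measurable_walshIncr _ _ _))
      (((measurable_pi_apply a).mul (hy b)).const_mul (2 * Y b) |>.sub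
        ((measurable_pi_apply a).const_mul (v : ℝ)))
      ((hxy.const_mul _).sub ((integrable_eval_gaussian v a).const_mul _)) hB
      fun x => ?_).trans ?_
    · refine le_trans ?_ (hcub x)
      have h1 := abs_Had_mulVec_le x b
      have h2 := Finset.single_le_sum (f := fun a => |x a|) (fun _ _ => abs_nonneg _)
        (Finset.mem_univ a)
      have e : walshIncr n v Y x (Sum.inl a) * walshIncr n v Y x (Sum.inr b)
          - (2 * Y b * (x a * (Had n).mulVec x b) - v * x a)
          = x a * (Had n).mulVec x b ^ 2 := by
        simp only [walshIncr, Sum.elim_inl, Sum.elim_inr]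
        ring
      simp only [Pi.mul_apply, Pi.sub_apply] at *
      rw [e, abs_mul, abs_pow]
      have h3 : 0 ≤ ∑ a, |x a| := Finset.sum_nonneg fun _ _ => abs_nonneg _
      have h4 : |x a| * |(Had n).mulVec x b| ^ 2 ≤ (∑ a, |x a|) * (∑ a, |x a|) ^ 2 := by
        gcongr
      nlinarith [pow_nonneg h3 3, sq_nonneg ((∑ a, |x a|) ^ 2 + v)]
    · rw [integral_const_mul]
      refine add_le_add ?_ le_rfl
      refine (congrArg abs hq).le.trans ?_
      rw [abs_mul, abs_mul, abs_mul, abs_Had, abs_two, abs_of_nonneg hv0, mul_one_div]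
      exact mul_le_of_le_one_left (by positivity) (by linarith [hY b])
  have hnonneg : 0 ≤ (v : ℝ) / √(2 ^ n) +
      2 * η ^ 3 * ∫ x : BV n → ℝ, Real.exp (4 * 2 ^ n / η * ∑ a, |x a|) ∂μ := by
    have := integral_nonneg (μ := μ)
      (f := fun x : BV n → ℝ => Real.exp (4 * 2 ^ n / η * ∑ a, |x a|))
      fun x => (Real.exp_pos _).le
    positivity
  rcases i with a | b <;> rcases j with a' | c
  · have hne : a ≠ a' := fun h => hij (by rw [h])
    simp only [walshIncr, Sum.elim_inl]
    rw [hμ, integral_eval_mul_eval_gaussian, if_neg hne, abs_zero]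
    exact hnonneg
  · exact hmixed a c
  · simp_rw [mul_comm (walshIncr n v Y _ (Sum.inr b))]
    exact hmixed a' b
  · have hne : b ≠ c := fun h => hij (by rw [h])
    have hyy : Integrable (fun x => (Had n).mulVec x b * (Had n).mulVec x c) μ :=
      (memLp_Had_mulVec v b).integrable_mul (memLp_Had_mulVec v c)
    set q : (BV n → ℝ) → ℝ := fun x => 4 * Y b * Y c * ((Had n).mulVec x b * (Had n).mulVec x c)
      - 2 * v * Y b * (Had n).mulVec x b - 2 * v * Y c * (Had n).mulVec x c with hqdef
    have hyyb : Integrable (fun x => 4 * Y b * Y c * ((Had n).mulVec x b * (Had n).mulVec x c)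
        - 2 * v * Y b * (Had n).mulVec x b) μ := (hyy.const_mul _).sub ((hy1 b).const_mul _)
    have hqi : Integrable q μ := hyyb.sub ((hy1 c).const_mul _)
    have hq : ∫ x, q x ∂μ = 0 := by
      simp only [hqdef]
      rw [integral_sub hyyb ((hy1 c).const_mul _),
        integral_sub (hyy.const_mul _) ((hy1 b).const_mul _), integral_const_mul,
        integral_const_mul, integral_const_mul, integral_Had_mulVec_mul_Had_mulVec, if_neg hne,
        integral_Had_mulVec, integral_Had_mulVec]
      ring
    refine (abs_integral_le_of_abs_sub_le
      ((measurable_walshIncr _ _ _).mul (measurable_walshIncr _ _ _))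
      (by fun_prop) hqi hB fun x => ?_).trans ?_
    · refine le_trans ?_ (hcub x)
      have hb := abs_Had_mulVec_le x b
      have hc := abs_Had_mulVec_le x c
      have hL : 0 ≤ ∑ a, |x a| := Finset.sum_nonneg fun _ _ => abs_nonneg _
      change |walshIncr n v Y x (Sum.inr b) * walshIncr n v Y x (Sum.inr c) - q x| ≤ _
      simp only [hqdef, walshIncr, Sum.elim_inr]
      generalize (Had n).mulVec x b = y at *
      generalize (Had n).mulVec x c = y' at *
      generalize ∑ a, |x a| = L at *
      have hsq : ∀ u : ℝ, |u| ≤ L → |u ^ 2 - v| ≤ L ^ 2 + v := by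
        intro u hu
        refine (abs_sub _ _).trans ?_
        rw [abs_pow, abs_of_nonneg hv0]
        gcongr
      have hcube : ∀ s u u' : ℝ, |s| ≤ 1 / 2 → |u| ≤ L → |u'| ≤ L →
          |2 * s * u * u' ^ 2| ≤ L ^ 3 := by
        intro s u u' hs hu hu'
        rw [abs_mul, abs_mul, abs_mul, abs_two, abs_pow]
        calc 2 * |s| * |u| * |u'| ^ 2 ≤ 2 * (1 / 2) * L * L ^ 2 := by gcongr
          _ = L ^ 3 := by ring
      have e : (2 * Y b * y + y ^ 2 - v) * (2 * Y c * y' + y' ^ 2 - v)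
          - (4 * Y b * Y c * (y * y') - 2 * v * Y b * y - 2 * v * Y c * y')
          = 2 * Y b * y * y' ^ 2 + 2 * Y c * y' * y ^ 2 + (y ^ 2 - v) * (y' ^ 2 - v) := by
        ring
      rw [e]
      have h3 : |(y ^ 2 - v) * (y' ^ 2 - v)| ≤ (L ^ 2 + v) ^ 2 := by
        rw [abs_mul, pow_two (L ^ 2 + _)]
        exact mul_le_mul (hsq y hb) (hsq y' hc) (abs_nonneg _) (by positivity)
      have h1 := hcube _ _ _ (hY b) hb hc
      have h2 := hcube _ _ _ (hY c) hc hb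
      have h4 := abs_add_three (2 * Y b * y * y' ^ 2) (2 * Y c * y' * y ^ 2)
        ((y ^ 2 - v) * (y' ^ 2 - v))
      linarith
    · rw [hq, abs_zero, integral_const_mul]
      exact add_le_add (by positivity) le_rfl

end Walsh

lemma eps_pos {C : ℝ} (hC : 20 ≤ C) {n : ℕ} (hn : 1 ≤ n) : 0 < eps C n := by
  have h : 0 < Real.log (2 ^ n) := Real.log_pos (one_lt_pow₀ (by norm_num) (by omega))
  unfold eps
  positivity

lemma eps_le_half {C : ℝ} (hC : 20 ≤ C) {n : ℕ} (hn : 1 ≤ n) : eps C n ≤ 1 / 2 := by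
  have h : Real.log 2 ≤ Real.log (2 ^ n) :=
    Real.log_le_log (by norm_num) (le_self_pow₀ (by norm_num) (by omega))
  have h2 := Real.log_two_gt_d9
  refine one_div_le_one_div_of_le (by norm_num) ?_
  nlinarith

/-- One Gaussian step of variance `v`, for `v` polynomially small in `N = 2^n`. -/
lemma abs_integral_walshIncr_sub_le {n : ℕ} (hn : 1 ≤ n) {v : NNReal} (hv0 : 0 < v)
    (hvN : (v : ℝ) * (2 ^ n) ^ 14 ≤ 1)
    {F : (BV n ⊕ BV n → ℝ) → ℝ} {c : Finset (BV n ⊕ BV n) → ℝ} {ℓ : ℝ}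
    (hF : ∀ z, F z = ∑ S : Finset (BV n ⊕ BV n), c S * ∏ i ∈ S, z i)
    (hL : ∀ (S : Finset (BV n ⊕ BV n)) (w : BV n ⊕ BV n → ℝ),
      (∀ i ∉ S, w i = 1 ∨ w i = -1) → L12 (restrictML F S w) ≤ ℓ)
    {z : BV n ⊕ BV n → ℝ} (hz : ∀ i, |z i| ≤ 1 / 2)
    {Y : BV n → ℝ} (hY : ∀ a, |Y a| ≤ 1 / 2) :
    |(∫ x, F (z + walshIncr n v Y x) ∂(Measure.pi fun _ => gaussianReal 0 v)) - F z|
      ≤ 2820 * v * ℓ / √(2 ^ n) := by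
  have hcard : Fintype.card (BV n) = 2 ^ n := by simp
  set N : ℝ := 2 ^ n with hN
  have hN2 : 2 ≤ N := le_self_pow₀ (by norm_num) (by omega)
  set μ : Measure (BV n → ℝ) := Measure.pi fun _ => gaussianReal 0 v with hμ
  set s : ℝ := √v with hs
  have hs0 : 0 < s := Real.sqrt_pos.mpr hv0
  have hss : s ^ 2 = v := Real.sq_sqrt v.coe_nonneg
  have hsN : s * N ^ 7 ≤ 1 := by
    rw [← sq_le_one_iff₀ (by positivity), mul_pow, hss, ← pow_mul]
    exact hvN
  set η : ℝ := 4 * N ^ 2 * s with hη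
  have hη0 : 0 < η := by positivity
  have hη1 : η ≤ 1 := by
    have h : (4 : ℝ) ≤ N ^ 5 := le_trans (by norm_num) (pow_le_pow_left₀ (by norm_num) hN2 5)
    calc η ≤ N ^ 5 * N ^ 2 * s := by simp only [hη]; gcongr
      _ = s * N ^ 7 := by ring
      _ ≤ 1 := hsN
  have hvη : (v : ℝ) ≤ η ^ 2 := by
    have h : (1 : ℝ) ≤ 16 * N ^ 4 := by
      have : (1 : ℝ) ≤ N ^ 4 := one_le_pow₀ (by linarith)
      linarith
    calc (v : ℝ) = 1 * s ^ 2 := by rw [hss, one_mul]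
      _ ≤ 16 * N ^ 4 * s ^ 2 := by gcongr
      _ = η ^ 2 := by simp only [hη]; ring
  obtain ⟨hEi, hE⟩ := integrable_exp_mul_sum_abs (ι := BV n) v (β := 4 * N / η)
  rw [← hμ] at hEi hE
  have hexp1 := Real.exp_one_lt_d9
  have hE4 : ∫ x : BV n → ℝ, Real.exp (4 * N / η * ∑ a, |x a|) ∂μ ≤ 4 := by
    have e : (v : ℝ) * (Fintype.card (BV n) * (4 * N / η)) ^ 2 / 2 = 1 / 2 := by
      rw [hcard, ← hss, hη]
      push_cast
      rw [← hN]
      field_simp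
    rw [e] at hE
    have h : Real.exp (1 / 2) ^ 2 = Real.exp 1 := by
      rw [← Real.exp_nat_mul]
      norm_num
    nlinarith [Real.exp_pos (1 / 2)]
  have hprod : ∀ x, ∏ i, (1 + |walshIncr n v Y x i| / η)
      ≤ 3 * Real.exp (4 * N / η * ∑ a, |x a|) := by
    intro x
    have hLx : 0 ≤ ∑ a, |x a| := Finset.sum_nonneg fun _ _ => abs_nonneg _
    calc ∏ i, (1 + |walshIncr n v Y x i| / η)
        ≤ ∏ _i : BV n ⊕ BV n, Real.exp (2 * ((∑ a, |x a|) / η) + v / η) := by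
          refine Finset.prod_le_prod (fun i _ => by positivity) fun i _ => ?_
          refine le_trans ?_ (one_add_div_le_exp hLx hη0 hη1 v.coe_nonneg)
          gcongr
          exact abs_walshIncr_le v hY x i
      _ = Real.exp (2 * N * v / η) * Real.exp (4 * N / η * ∑ a, |x a|) := by
          rw [Finset.prod_const, Finset.card_univ, Fintype.card_sum, hcard, ← Real.exp_nat_mul,
            ← Real.exp_add]
          push_cast
          rw [← hN]
          congr 1
          field_simp
          ring
      _ ≤ 3 * Real.exp (4 * N / η * ∑ a, |x a|) := by
          gcongr
          have h1 : 2 * N * v / η ≤ 1 := by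
            rw [div_le_one hη0, ← hss, hη]
            have h2 : s ≤ 1 := le_trans (le_mul_of_one_le_right hs0.le
              (one_le_pow₀ (by linarith))) hsN
            have h3 : 0 ≤ N * s := by positivity
            nlinarith
          exact (Real.exp_le_exp.mpr h1).trans (by linarith)
  have hη3 : η ^ 3 ≤ 64 * (v / √N) := by
    have hroot : √N ≤ N := Real.sqrt_le_self_iff.mpr (by right; linarith)
    have h : s * N ^ 6 ≤ 1 / √N := by
      rw [le_div_iff₀ (by positivity)]
      calc s * N ^ 6 * √N ≤ s * N ^ 6 * N := by gcongr
        _ = s * N ^ 7 := by ring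
        _ ≤ 1 := hsN
    calc η ^ 3 = 64 * (s ^ 2 * (s * N ^ 6)) := by simp only [hη]; ring
      _ ≤ 64 * (v * (1 / √N)) := by rw [hss]; gcongr
      _ = 64 * (v / √N) := by ring
  have hℓ : 0 ≤ ℓ := le_trans (Finset.sum_nonneg fun _ _ => abs_nonneg _)
    (hL Finset.univ (fun _ => 1) (by simp))
  have hE0 : 0 ≤ ∫ x : BV n → ℝ, Real.exp (4 * N / η * ∑ a, |x a|) ∂μ :=
    integral_nonneg fun _ => (Real.exp_pos _).le
  have h := abs_integral_multilinear_sub_le (μ := μ) hF hL hz (measurable_walshIncr (v : ℝ) Y)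
    hη0 hη1 (hEi.const_mul 3) hprod (integral_walshIncr v)
    (by positivity) fun i j hij => abs_integral_walshIncr_mul_le v hY hη0 hη1 hvη hij
  refine h.trans ?_
  rw [integral_const_mul, ← hN, ← hμ]
  generalize (∫ x : BV n → ℝ, Real.exp (4 * N / η * ∑ a, |x a|) ∂μ) = E at hE4 hE0 ⊢
  calc 4 * ℓ * (v / √N + 2 * η ^ 3 * E) + ℓ * (η ^ 3 * (3 * E))
      = ℓ * (4 * (v / √N) + 11 * (η ^ 3 * E)) := by ring
    _ ≤ ℓ * (4 * (v / √N) + 11 * (64 * (v / √N) * 4)) := by gcongr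
    _ = 2820 * v * ℓ / √N := by ring

/-- There exist universal constants `c ≥ 3` and `K` such that, with
`t = N^{c-1}`: for `(X, Y) ∈ [-1/2, 1/2]^{2N}`, `ΔX` centered Gaussian with covariance
`(ε/t) I_N`, `ΔY = H ΔX`, and `F : ℝ^{2N} → ℝ` multilinear mapping `{±1}^{2N}` into
`[-1,1]` with `L_{1,2}(F_ρ) ≤ ℓ` for every restriction `ρ`, for every `1 ≤ i ≤ t`:
`|E_{ΔX}[F(X + ΔX, (Y+ΔY)∘(Y+ΔY) - (iε/t)𝟙)] - F(X, Y∘Y - ((i-1)ε/t)𝟙)|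
  ≤ K ε ℓ / (t √N)`. -/
theorem stmt11 :
    ∃ (c : ℕ) (K : ℝ), 3 ≤ c ∧
      ∀ C : ℝ, 20 ≤ C → ∀ n : ℕ, 1 ≤ n → ∀ ℓ : ℝ,
      ∀ X Y : BV n → ℝ, (∀ a, |X a| ≤ 1 / 2) → (∀ a, |Y a| ≤ 1 / 2) →
      ∀ F : (BV n ⊕ BV n → ℝ) → ℝ, IsMultilinear F →
        (∀ z : BV n ⊕ BV n → ℝ, (∀ i, z i = 1 ∨ z i = -1) → |F z| ≤ 1) →
        (∀ (S : Finset (BV n ⊕ BV n)) (w : BV n ⊕ BV n → ℝ),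
            (∀ i ∉ S, w i = 1 ∨ w i = -1) → L12 (restrictML F S w) ≤ ℓ) →
      ∀ i : ℕ, 1 ≤ i → i ≤ (2 ^ n) ^ (c - 1) →
        |(∫ dX, F (Sum.elim (fun a => X a + dX a)
              (fun a => (Y a + (Had n).mulVec dX a) ^ 2
                - (i : ℝ) * eps C n / ((2 : ℝ) ^ n) ^ (c - 1)))
            ∂(gaussStep C n (((2 : ℝ) ^ n) ^ (c - 1))))
          - F (Sum.elim X
              (fun a => Y a ^ 2 - ((i - 1 : ℕ) : ℝ) * eps C n / ((2 : ℝ) ^ n) ^ (c - 1)))|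
          ≤ K * eps C n * ℓ / ((((2 : ℝ) ^ n) ^ (c - 1)) * Real.sqrt (2 ^ n)) := by
  refine ⟨15, 2820, by norm_num, ?_⟩
  intro C hC n hn ℓ X Y hX hY F hF _ hL i hi1 hi
  obtain ⟨c, hc⟩ := hF
  have hε0 := eps_pos hC hn
  have hε := eps_le_half hC hn
  simp only [Nat.add_one_sub_one] at *
  set t : ℝ := ((2 : ℝ) ^ n) ^ (15 - 1) with ht
  have ht0 : 0 < t := by positivity
  have hit : (i : ℝ) ≤ t := by
    rw [ht]
    exact_mod_cast hi
  have hcast : ((i - 1 : ℕ) : ℝ) = i - 1 := by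
    rw [Nat.cast_sub hi1, Nat.cast_one]
  have hi1' : (1 : ℝ) ≤ i := by exact_mod_cast hi1
  set v : NNReal := (eps C n / t).toNNReal with hv
  have hvc : (v : ℝ) = eps C n / t := Real.coe_toNNReal _ (by positivity)
  set z : BV n ⊕ BV n → ℝ := Sum.elim X
    (fun a => Y a ^ 2 - ((i - 1 : ℕ) : ℝ) * eps C n / t) with hz
  have hz2 : ∀ j, |z j| ≤ 1 / 2 := by
    rintro (a | a)
    · exact hX a
    · have h1 := abs_le.mp (hY a)
      have h2 : Y a ^ 2 ≤ 1 / 4 := by nlinarith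
      have h3 : ((i - 1 : ℕ) : ℝ) * eps C n / t ≤ 1 / 2 := by
        rw [hcast, div_le_iff₀ ht0]
        nlinarith
      have h4 : 0 ≤ ((i - 1 : ℕ) : ℝ) * eps C n / t := by positivity
      simp only [hz, Sum.elim_inr]
      exact abs_le.mpr ⟨by nlinarith, by linarith⟩
  have hmove : ∀ x : BV n → ℝ, (Sum.elim (fun a => X a + x a)
      (fun a => (Y a + (Had n).mulVec x a) ^ 2 - (i : ℝ) * eps C n / t))
      = z + walshIncr n v Y x := by
    intro x
    funext j
    rcases j with a | a
    · rfl
    · simp only [hz, walshIncr, Pi.add_apply, Sum.elim_inr, hcast, hvc]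
      ring
  have h := abs_integral_walshIncr_sub_le hn (v := v)
    (Real.toNNReal_pos.mpr (by positivity))
    (by rw [hvc]; change eps C n / t * t ≤ 1; rw [div_mul_cancel₀ _ ht0.ne']; linarith)
    hc hL hz2 hY
  simp_rw [hmove, gaussStep]
  refine h.trans_eq ?_
  rw [hvc]
  field_simp
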